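/- arXiv:1412.3006 — 2 statements merged into one kernel-verified Lean document; each statement's English description precedes it below -/
import Mathlib

section
/- For any Vasil'ev code V_C^λ, every permutation ρ ∈ Rot(V_C^λ) that fixes position n+1 is of the form ρ = σ_π ∘ τ_u for some π ∈ S_n and u ∈ F^n. -/
set_option linter.unusedSectionVars false

/-- Binary vectors of length `|ι|`, indexed by `ι`. -/
abbrev F (ι : Type*) : Type _ := ι → ZMod 2

section Defs

variable {ι : Type*}

/-- The support of a vector: the set of its nonzero coordinate positions. -/
def supp (x : F ι) : Set ι := {i | x i ≠ 0}

/-- Action of a permutation on binary vectors by permuting coordinates: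
`(permAct π x) (π i) = x i`. -/
def permAct (π : Equiv.Perm ι) (x : F ι) : F ι := x ∘ π.symm

/-- The image `π(C)` of a code under a coordinate permutation. -/
def permCode (π : Equiv.Perm ι) (C : Set (F ι)) : Set (F ι) := permAct π '' C

/-- The translateCode `y + C` of a code. -/
def translateCode (y : F ι) (C : Set (F ι)) : Set (F ι) := (y + ·) '' C

/-- `Sym(C) = {π : π(C) = C}`. -/
def SymSet (C : Set (F ι)) : Set (Equiv.Perm ι) := {π | permCode π C = C}

/-- `Rot(C) = {π : ∃ y ∈ C, y + π(C) = C}`. -/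
def RotSet (C : Set (F ι)) : Set (Equiv.Perm ι) :=
  {π | ∃ y ∈ C, translateCode y (permCode π C) = C}

/-- `Rot_y(C) = {π : y + π(C) = C}`. -/
def RotAt (C : Set (F ι)) (y : F ι) : Set (Equiv.Perm ι) :=
  {π | translateCode y (permCode π C) = C}

/-- `Tr(C) = {y ∈ C : ∃ π, y + π(C) = C}`. -/
def TrSet (C : Set (F ι)) : Set (F ι) :=
  {y | y ∈ C ∧ ∃ π : Equiv.Perm ι, translateCode y (permCode π C) = C}

/-- `Ker(C) = {x ∈ C : x + C = C}`. -/
def KerSet (C : Set (F ι)) : Set (F ι) := {x | x ∈ C ∧ translateCode x C = C}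

/-- `Aut(C) = {(y, π) : y + π(C) = C}`. -/
def AutSet (C : Set (F ι)) : Set (F ι × Equiv.Perm ι) :=
  {p | translateCode p.1 (permCode p.2 C) = C}

/-- A (reduced) code is transitive if for every codeword `y` there is a permutation `π`
with `y + π(C) = C`. -/
def IsTransitive (C : Set (F ι)) : Prop :=
  ∀ y ∈ C, ∃ π : Equiv.Perm ι, translateCode y (permCode π C) = C

/-- A code is propelinear if `Aut(C)` contains a subgroup acting regularly on `C`
(the group law is `(y, π) * (y', π') = (y + π(y'), π ∘ π')`, acting by `(y,π) • x = y + π(x)`). -/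
def IsPropelinear (C : Set (F ι)) : Prop :=
  ∃ A : Set (F ι × Equiv.Perm ι),
    (∀ a ∈ A, translateCode a.1 (permCode a.2 C) = C) ∧
    ((0, 1) ∈ A) ∧
    (∀ a ∈ A, ∀ b ∈ A, (a.1 + permAct a.2 b.1, a.2 * b.2) ∈ A) ∧
    (∀ a ∈ A, (permAct a.2⁻¹ a.1, a.2⁻¹) ∈ A) ∧
    (∀ c ∈ C, ∀ c' ∈ C, ∃! a, a ∈ A ∧ a.1 + permAct a.2 c = c')

variable [Fintype ι] [DecidableEq ι]

/-- A perfect (1-error-correcting) code: every vector is within Hamming distance 1 of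
exactly one codeword. -/
def IsPerfect (C : Set (F ι)) : Prop :=
  ∀ x : F ι, ∃! c, c ∈ C ∧ hammingDist x c ≤ 1

/-- `STS(C, y) = {supp (x + y) : x ∈ C, d(x, y) = 3}`. -/
def STS (C : Set (F ι)) (y : F ι) : Set (Set ι) :=
  {s | ∃ x ∈ C, hammingDist x y = 3 ∧ s = supp (x + y)}

/-- A reduced perfect code is homogeneous if each `STS(C,y)`, `y ∈ C`, is isomorphic
to `STS(C, 0)`. -/
def IsHomogeneous (C : Set (F ι)) : Prop :=
  ∀ y ∈ C, ∃ π : Equiv.Perm ι, (Set.image π) '' (STS C y) = STS C (0 : F ι)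

/-- The (mod 2) weight `|x| = x_1 + ⋯ + x_n`. -/
def wt (x : F ι) : ZMod 2 := ∑ i, x i

/-- The scalar product `u · y = Σ u_i y_i (mod 2)`. -/
def dot (u y : F ι) : ZMod 2 := ∑ i, u i * y i

/-- A linear code: a subspace of `F ι` (over `ZMod 2` it suffices to be closed under `+`). -/
def IsLinearCode (C : Set (F ι)) : Prop :=
  (0 : F ι) ∈ C ∧ ∀ x ∈ C, ∀ y ∈ C, x + y ∈ C

/-- A Hamming code: a linear perfect code. -/
def IsHammingCode (C : Set (F ι)) : Prop := IsLinearCode C ∧ IsPerfect C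

/-- The `i`-component `R_i`: the linear span of the weight-3 codewords of `H` whose
support contains `i`. -/
def component (H : Set (F ι)) (i : ι) : Set (F ι) :=
  ↑(Submodule.span (ZMod 2) {x | x ∈ H ∧ hammingNorm x = 3 ∧ x i ≠ 0})

/-- `lam` pierces `R` if it takes both values 0 and 1 on `R`. -/
def Pierces (lam : F ι → ZMod 2) (R : Set (F ι)) : Prop :=
  (∃ x ∈ R, lam x = 0) ∧ (∃ x ∈ R, lam x = 1)

/-- The vector `(a, b, c)` of length `2n+1`: coordinates `1..n` are `a`, coordinate `n+1`
is `b`, coordinates `n+2..2n+1` are `c`. -/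
def vasVec (a : F ι) (b : ZMod 2) (c : F ι) : F (ι ⊕ Unit ⊕ ι) :=
  Sum.elim a (Sum.elim (fun _ => b) c)

/-- The Vasil'ev code `V_C^λ = {(x + y, |x| + λ(y), x) : x ∈ F^n, y ∈ C}`. -/
def Vasiliev (C : Set (F ι)) (lam : F ι → ZMod 2) : Set (F (ι ⊕ Unit ⊕ ι)) :=
  {v | ∃ x : F ι, ∃ y ∈ C, v = vasVec (x + y) (wt x + lam y) x}

/-- The subspace `R_{n+1}^{2n+1} = {(x, |x|, x) : x ∈ F^n}`. -/
def Rmid : Set (F (ι ⊕ Unit ⊕ ι)) := {v | ∃ x : F ι, v = vasVec x (wt x) x}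

/-- Underlying function of `τ_u`: swaps positions `i` and `i + n + 1` for `i ∈ supp u`. -/
def tauFun (u : F ι) : (ι ⊕ Unit ⊕ ι) → (ι ⊕ Unit ⊕ ι)
  | Sum.inl i => if u i ≠ 0 then Sum.inr (Sum.inr i) else Sum.inl i
  | Sum.inr (Sum.inl _) => Sum.inr (Sum.inl ())
  | Sum.inr (Sum.inr i) => if u i ≠ 0 then Sum.inl i else Sum.inr (Sum.inr i)

theorem tauFun_involutive (u : F ι) : Function.Involutive (tauFun u) := by
  intro x
  rcases x with i | x
  · by_cases h : u i = 0 <;> simp [tauFun, h]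
  · rcases x with u' | i
    · simp [tauFun]
    · by_cases h : u i = 0 <;> simp [tauFun, h]

/-- The permutation `τ_u`: the product of transpositions `(i, i+n+1)` over `i ∈ supp u`. -/
def tau (u : F ι) : Equiv.Perm (ι ⊕ Unit ⊕ ι) :=
  Function.Involutive.toPerm (tauFun u) (tauFun_involutive u)

/-- The duplicator `σ_π`: fixes position `n+1`, sends `i ↦ π(i)` and `i+n+1 ↦ π(i)+n+1`. -/
def dup (π : Equiv.Perm ι) : Equiv.Perm (ι ⊕ Unit ⊕ ι) :=
  Equiv.sumCongr π (Equiv.sumCongr (Equiv.refl Unit) π)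

/-- The extension of `λ` one step up the Vasil'ev recursion: `λ'(z) = λ(y)` for
`z ∈ (y, 0^{m+1}) + R_{m+1}^{2m+1}` (well defined by recovering `y` from `z`). -/
def lamSucc (lam : F ι → ZMod 2) : F (ι ⊕ Unit ⊕ ι) → ZMod 2 :=
  fun z => lam (fun i => z (Sum.inl i) + z (Sum.inr (Sum.inr i)))

/-- `T = {y' ∈ H : (y', λ(y'), 0) ∈ Tr(V_H^λ)}`. -/
def Tset (H : Set (F ι)) (lam : F ι → ZMod 2) : Set (F ι) :=
  {y' | y' ∈ H ∧ vasVec y' (lam y') 0 ∈ TrSet (Vasiliev H lam)}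

/-- The Assmus–Mattson Steiner triple system `S^θ` of order `2n+1`. -/
def AM (S : Set (Set ι)) (θ : Set ι → ZMod 2) : Set (Set (ι ⊕ Unit ⊕ ι)) :=
  {T | (∃ i : ι, T = {Sum.inl i, Sum.inr (Sum.inl ()), Sum.inr (Sum.inr i)}) ∨
    (∃ s ∈ S, θ s = 0 ∧
      (T = Sum.inl '' s ∨
        ∃ a ∈ s, T = insert (Sum.inl a) ((fun i => Sum.inr (Sum.inr i)) '' (s \ {a})))) ∨
    (∃ s ∈ S, θ s = 1 ∧
      (T = (fun i => Sum.inr (Sum.inr i)) '' s ∨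
        ∃ a ∈ s, T = insert (Sum.inr (Sum.inr a)) (Sum.inl '' (s \ {a}))))}

end Defs

/-- A Steiner triple system on the point set `α`. -/
def IsSTS {α : Type*} (S : Set (Set α)) : Prop :=
  (∀ s ∈ S, s.ncard = 3) ∧ ∀ i j : α, i ≠ j → ∃! s, s ∈ S ∧ i ∈ s ∧ j ∈ s

/-- The Mollard code (with zero function) of the codes `C` and `D`. -/
def Mollard {t r : Type*} [Fintype t] [Fintype r] (C : Set (F t)) (D : Set (F r)) :
    Set (F ((t × r) ⊕ t ⊕ r)) :=
  {v | ∃ x : F (t × r), ∃ c ∈ C, ∃ d ∈ D,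
    v = Sum.elim x (Sum.elim (fun i => c i + ∑ j, x (i, j)) (fun j => d j + ∑ i, x (i, j)))}

/-- Index types of the iterated Vasil'ev construction: lengths `n`, `2n+1`, `4n+3`, …. -/
def HType (n : ℕ) : ℕ → Type
  | 0 => Fin n
  | s + 1 => HType n s ⊕ Unit ⊕ HType n s

def HType.ft (n : ℕ) : ∀ s, Fintype (HType n s)
  | 0 => inferInstanceAs (Fintype (Fin n))
  | s + 1 =>
      letI := HType.ft n s
      inferInstanceAs (Fintype (HType n s ⊕ Unit ⊕ HType n s))

instance (n s : ℕ) : Fintype (HType n s) := HType.ft n s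

def HType.deq (n : ℕ) : ∀ s, DecidableEq (HType n s)
  | 0 => inferInstanceAs (DecidableEq (Fin n))
  | s + 1 =>
      letI := HType.deq n s
      inferInstanceAs (DecidableEq (HType n s ⊕ Unit ⊕ HType n s))

instance (n s : ℕ) : DecidableEq (HType n s) := HType.deq n s

/-- The iterated Hamming codes `H^n, H^{2n+1} = V_{H^n}^0, H^{4n+3}, …`. -/
def Hcode (n : ℕ) (H : Set (F (Fin n))) : ∀ s, Set (F (HType n s))
  | 0 => H
  | s + 1 => Vasiliev (Hcode n H s) 0

/-- The iterated functions `λ_n = λ`, `λ_{2m+1}` extending `λ_m`. -/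
def lamIter (n : ℕ) (lam : F (Fin n) → ZMod 2) : ∀ s, F (HType n s) → ZMod 2
  | 0 => lam
  | s + 1 => lamSucc (lamIter n lam s)

/-- `C_0 = V_{H^n}^λ`, `C_{s+1} = V_{C_s}^0`. -/
def Ccode (n : ℕ) (H : Set (F (Fin n))) (lam : F (Fin n) → ZMod 2) :
    ∀ s, Set (F (HType n (s + 1)))
  | 0 => Vasiliev H lam
  | s + 1 => Vasiliev (Ccode n H lam s) 0

section VasilievRotation

variable {ι : Type*} [Fintype ι] [DecidableEq ι]

theorem hammingDist_add_single_le_one (x : F ι) (j : ι) (a : ZMod 2) :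
    hammingDist (x + Pi.single j a) x ≤ 1 := by
  refine (Finset.card_le_card (t := {j}) fun i hi => ?_).trans (Finset.card_singleton j).le
  by_contra hne
  simp_all

/-- Two codewords of a perfect code differing by two unit vectors are equal. -/
theorem IsPerfect.eq_of_add_single_add_single_mem {C : Set (F ι)} (hC : IsPerfect C) {c : F ι}
    (hc : c ∈ C) {j k : ι} (h : c + (Pi.single j 1 + Pi.single k 1) ∈ C) : j = k := by
  have h1 : hammingDist (c + Pi.single j 1) c ≤ 1 := hammingDist_add_single_le_one c j 1
  have h2 : hammingDist (c + Pi.single j 1) (c + (Pi.single j 1 + Pi.single k 1)) ≤ 1 := by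
    rw [hammingDist_comm, ← add_assoc]
    exact hammingDist_add_single_le_one _ k 1
  have heq := (hC (c + Pi.single j 1)).unique ⟨hc, h1⟩ ⟨h, h2⟩
  by_contra hjk
  have := congrFun heq j
  simp [hjk] at this

/-- The sum of the left and right halves of a vector of length `2n+1`. -/
def fold (v : F (ι ⊕ Unit ⊕ ι)) : F ι := fun i => v (Sum.inl i) + v (Sum.inr (Sum.inr i))

theorem fold_add (v w : F (ι ⊕ Unit ⊕ ι)) : fold (v + w) = fold v + fold w := by
  funext i
  simp only [fold, Pi.add_apply]
  ring

theorem fold_mem {C : Set (F ι)} {lam : F ι → ZMod 2} {v : F (ι ⊕ Unit ⊕ ι)}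
    (hv : v ∈ Vasiliev C lam) : fold v ∈ C := by
  obtain ⟨x, y, hy, rfl⟩ := hv
  convert hy using 1
  funext i
  simp only [fold, vasVec, Sum.elim_inl, Sum.elim_inr, Pi.add_apply]
  linear_combination CharTwo.add_self_eq_zero (x i)

theorem fold_single_inl (j : ι) : fold (Pi.single (Sum.inl j) 1) = Pi.single j 1 := by
  funext i
  simp [fold, Pi.single_apply]

theorem fold_single_inr (j : ι) : fold (Pi.single (Sum.inr (Sum.inr j)) 1) = Pi.single j 1 := by
  funext i
  simp [fold, Pi.single_apply]

theorem fold_single_mid : fold (Pi.single (Sum.inr (Sum.inl ())) 1 : F (ι ⊕ Unit ⊕ ι)) = 0 := by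
  funext i
  simp [fold]

theorem permAct_add (ρ : Equiv.Perm ι) (x y : F ι) :
    permAct ρ (x + y) = permAct ρ x + permAct ρ y := rfl

theorem permAct_single (ρ : Equiv.Perm ι) (i : ι) (a : ZMod 2) :
    permAct ρ (Pi.single i a) = Pi.single (ρ i) a := by
  funext k
  simp [permAct, Pi.single_apply, Equiv.symm_apply_eq]

theorem triple_mem_Vasiliev {C : Set (F ι)} (h0 : 0 ∈ C) {lam : F ι → ZMod 2} (hlam : lam 0 = 0)
    (i : ι) :
    Pi.single (Sum.inl i) 1 + Pi.single (Sum.inr (Sum.inr i)) 1 +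
      Pi.single (Sum.inr (Sum.inl ())) 1 ∈ Vasiliev C lam := by
  refine ⟨Pi.single i 1, 0, h0, ?_⟩
  funext k
  rcases k with k | k | k <;> simp [vasVec, wt, hlam, Pi.single_apply]

/-- A rotation of a Vasil'ev code fixing the middle position permutes the pairs of
twin positions. -/
theorem exists_twin_image {C : Set (F ι)} (h0 : 0 ∈ C) (hC : IsPerfect C)
    {lam : F ι → ZMod 2} (hlam : lam 0 = 0) {ρ : Equiv.Perm (ι ⊕ Unit ⊕ ι)}
    (hρ : ρ ∈ RotSet (Vasiliev C lam))
    (hfix : ρ (Sum.inr (Sum.inl ())) = Sum.inr (Sum.inl ())) (i : ι) :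
    ∃ j, (ρ (Sum.inl i) = Sum.inl j ∧ ρ (Sum.inr (Sum.inr i)) = Sum.inr (Sum.inr j)) ∨
      (ρ (Sum.inl i) = Sum.inr (Sum.inr j) ∧ ρ (Sum.inr (Sum.inr i)) = Sum.inl j) := by
  obtain ⟨y, hy, hrot⟩ := hρ
  have hmem : y + permAct ρ (Pi.single (Sum.inl i) 1 + Pi.single (Sum.inr (Sum.inr i)) 1 +
      Pi.single (Sum.inr (Sum.inl ())) 1) ∈ Vasiliev C lam := by
    rw [← hrot]
    exact ⟨_, ⟨_, triple_mem_Vasiliev h0 hlam i, rfl⟩, rfl⟩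
  have hfold := fold_mem hmem
  simp only [permAct_add, permAct_single, hfix, fold_add, fold_single_mid, add_zero] at hfold
  have hne : ρ (Sum.inl i) ≠ ρ (Sum.inr (Sum.inr i)) := fun h => by simpa using ρ.injective h
  have hl : ρ (Sum.inl i) ≠ Sum.inr (Sum.inl ()) := fun h => by
    simpa using ρ.injective (h.trans hfix.symm)
  have hr : ρ (Sum.inr (Sum.inr i)) ≠ Sum.inr (Sum.inl ()) := fun h => by
    simpa using ρ.injective (h.trans hfix.symm)
  rcases hp : ρ (Sum.inl i) with j | ⟨⟩ | j
  · rcases hq : ρ (Sum.inr (Sum.inr i)) with k | ⟨⟩ | k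
    · rw [hp, hq, fold_single_inl, fold_single_inl] at hfold
      have hjk := hC.eq_of_add_single_add_single_mem (fold_mem hy) hfold
      exact absurd (by rw [hp, hq, hjk]) hne
    · exact absurd hq hr
    · rw [hp, hq, fold_single_inl, fold_single_inr] at hfold
      obtain rfl := hC.eq_of_add_single_add_single_mem (fold_mem hy) hfold
      exact ⟨j, Or.inl ⟨rfl, rfl⟩⟩
  · exact absurd hp hl
  · rcases hq : ρ (Sum.inr (Sum.inr i)) with k | ⟨⟩ | k
    · rw [hp, hq, fold_single_inl, fold_single_inr] at hfold
      obtain rfl := hC.eq_of_add_single_add_single_mem (fold_mem hy) hfold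
      exact ⟨j, Or.inr ⟨rfl, rfl⟩⟩
    · exact absurd hq hr
    · rw [hp, hq, fold_single_inr, fold_single_inr] at hfold
      have hjk := hC.eq_of_add_single_add_single_mem (fold_mem hy) hfold
      exact absurd (by rw [hp, hq, hjk]) hne

end VasilievRotation

/-- any `ρ ∈ Rot(V_C^λ)` fixing position `n+1` has the form `σ_π ∘ τ_u`. -/
theorem stmt9 {n : ℕ} (C : Set (F (Fin n))) (h0 : (0 : F (Fin n)) ∈ C)
    (hC : IsPerfect C) (lam : F (Fin n) → ZMod 2) (hlam : lam 0 = 0)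
    (ρ : Equiv.Perm (Fin n ⊕ Unit ⊕ Fin n)) (hρ : ρ ∈ RotSet (Vasiliev C lam))
    (hfix : ρ (Sum.inr (Sum.inl ())) = Sum.inr (Sum.inl ())) :
    ∃ (π : Equiv.Perm (Fin n)) (u : F (Fin n)), ρ = dup π * tau u := by
  choose f hf using exists_twin_image h0 hC hlam hρ hfix
  have hinj : Function.Injective f := fun i k hik => by
    rcases hf i with ⟨hi, hi'⟩ | ⟨hi, hi'⟩ <;> rcases hf k with ⟨hk, hk'⟩ | ⟨hk, hk'⟩ <;>
      rw [← hik] at hk hk'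
    · simpa using ρ.injective (hi.trans hk.symm)
    · simpa using ρ.injective (hi.trans hk'.symm)
    · simpa using ρ.injective (hi.trans hk'.symm)
    · simpa using ρ.injective (hi.trans hk.symm)
  refine ⟨Equiv.ofBijective f (Finite.injective_iff_bijective.mp hinj),
    fun i => if ρ (Sum.inl i) = Sum.inl (f i) then 0 else 1, Equiv.ext fun p => ?_⟩
  rcases p with i | ⟨⟩ | i
  · rcases hf i with ⟨hi, hi'⟩ | ⟨hi, hi'⟩ <;> simp [dup, tau, tauFun, hi]
  · simp [dup, tau, tauFun, hfix]
  · rcases hf i with ⟨hi, hi'⟩ | ⟨hi, hi'⟩ <;> simp [dup, tau, tauFun, hi, hi']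
end

section
/- The perfect codes V22^1 and V3^11 of length 15 are homogeneous. -/
set_option linter.unusedSectionVars false

/-- Characteristic vector of a finite set of coordinates. -/
def chi (s : Finset (Fin 7)) : F (Fin 7) := fun i => if i ∈ s then 1 else 0

/-- The Hamming code of length 7 spanned by the vectors with supports
`{1,2,3}, {1,4,5}, {1,6,7}, {2,4,6}` (in 0-indexed form `{0,1,2}, {0,3,4}, {0,5,6}, {1,3,5}`). -/
def H7 : Set (F (Fin 7)) :=
  ↑(Submodule.span (ZMod 2)
      ({chi {0, 1, 2}, chi {0, 3, 4}, chi {0, 5, 6}, chi {1, 3, 5}} : Set (F (Fin 7))))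

/-- The function `λ` of the code `V22^1`: `0` exactly on the codewords with supports
`∅, {1,6,7}, {1,3,5,7}, {1,…,7}` (0-indexed: `∅, {0,5,6}, {0,2,4,6}, {0,…,6}`). -/
def lamV22 : F (Fin 7) → ZMod 2 := fun x =>
  if x = chi ∅ ∨ x = chi {0, 5, 6} ∨ x = chi {0, 2, 4, 6} ∨ x = chi {0, 1, 2, 3, 4, 5, 6}
  then 0 else 1

/-- The function `μ` of the code `V3^11`: `0` exactly on the codewords with supports
`∅, {1,6,7}, {2,4,6}, {4,5,6,7}` (0-indexed: `∅, {0,5,6}, {1,3,5}, {3,4,5,6}`). -/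
def lamV3 : F (Fin 7) → ZMod 2 := fun x =>
  if x = chi ∅ ∨ x = chi {0, 5, 6} ∨ x = chi {1, 3, 5} ∨ x = chi {3, 4, 5, 6}
  then 0 else 1

section Homogeneity

variable {ι : Type*}

theorem add_self_eq_zero_of_binary (x : F ι) : x + x = 0 :=
  funext fun i => CharTwo.add_self_eq_zero (x i)

theorem mem_vasiliev [Fintype ι] {C : Set (F ι)} {lam : F ι → ZMod 2} {a c : F ι} {b : ZMod 2} :
    vasVec a b c ∈ Vasiliev C lam ↔ a + c ∈ C ∧ b = wt c + lam (a + c) := by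
  constructor
  · rintro ⟨x, y, hy, h⟩
    have ha : a = x + y := funext fun i => congrFun h (Sum.inl i)
    have hb : b = wt x + lam y := congrFun h (Sum.inr (Sum.inl ()))
    have hc : c = x := funext fun i => congrFun h (Sum.inr (Sum.inr i))
    have hac : x + y + x = y := by
      rw [add_right_comm, add_self_eq_zero_of_binary, zero_add]
    subst ha hb hc
    rw [hac]
    exact ⟨hy, rfl⟩
  · rintro ⟨h, rfl⟩
    refine ⟨c, a + c, h, ?_⟩
    rw [add_left_comm, add_self_eq_zero_of_binary, add_zero]

theorem exists_eq_vasVec (v : F (ι ⊕ Unit ⊕ ι)) : ∃ a b c, v = vasVec a b c := by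
  refine ⟨fun i => v (Sum.inl i), v (Sum.inr (Sum.inl ())), fun i => v (Sum.inr (Sum.inr i)), ?_⟩
  funext i
  rcases i with i | i | i <;> rfl

theorem vasVec_add (a a' c c' : F ι) (b b' : ZMod 2) :
    vasVec a b c + vasVec a' b' c' = vasVec (a + a') (b + b') (c + c') := by
  funext i
  rcases i with i | i | i <;> rfl

theorem permAct_mul (σ τ : Equiv.Perm ι) (x : F ι) :
    permAct (σ * τ) x = permAct σ (permAct τ x) := rfl

theorem permAct_dup_vasVec (σ : Equiv.Perm ι) (a c : F ι) (b : ZMod 2) :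
    permAct (dup σ) (vasVec a b c) = vasVec (permAct σ a) b (permAct σ c) := by
  funext i
  rcases i with i | i | i <;> rfl

theorem permAct_tau_vasVec [Fintype ι] [DecidableEq ι] (u a c : F ι) (b : ZMod 2) :
    permAct (tau u) (vasVec a b c) = vasVec (a + u * (a + c)) b (c + u * (a + c)) := by
  have key : ∀ s t r : ZMod 2, (if s ≠ 0 then r else t) = t + s * (t + r) := by decide
  funext i
  rcases i with i | i | i
  · change Sum.elim a _ (if u i ≠ 0 then _ else _) = a i + u i * (a i + c i)
    rw [← key]
    split_ifs <;> rfl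
  · rfl
  · change Sum.elim a _ (if u i ≠ 0 then _ else _) = c i + u i * (a i + c i)
    rw [add_comm (a i), ← key]
    split_ifs <;> rfl

theorem supp_permAct (π : Equiv.Perm ι) (v : F ι) : supp (permAct π v) = π '' supp v := by
  ext i
  rw [Equiv.image_eq_preimage_symm]
  rfl

variable [Fintype ι]

theorem wt_add (x y : F ι) : wt (x + y) = wt x + wt y := Finset.sum_add_distrib

theorem wt_permAct (π : Equiv.Perm ι) (x : F ι) : wt (permAct π x) = wt x :=
  Equiv.sum_comp π.symm x

theorem hammingNorm_permAct (π : Equiv.Perm ι) (v : F ι) :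
    hammingNorm (permAct π v) = hammingNorm v := by
  rw [hammingNorm, hammingNorm]
  exact Finset.card_equiv π.symm fun i => by
    rw [Finset.mem_filter_univ, Finset.mem_filter_univ]
    rfl

theorem hammingNorm_add_le_vasVec (a c : F ι) (b : ZMod 2) :
    hammingNorm (a + c) ≤ hammingNorm (vasVec a b c) := by
  have hac : hammingNorm (a + c) ≤ hammingNorm a + hammingNorm c := by
    have h := hammingDist_triangle a 0 (-c)
    rw [hammingDist_zero_right, hammingDist_zero_left, hammingDist_eq_hammingNorm] at h
    simpa [hammingNorm, sub_eq_add_neg] using h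
  refine hac.trans ?_
  simp only [hammingNorm, Finset.card_filter]
  rw [Fintype.sum_sum_type, Fintype.sum_sum_type]
  exact add_le_add_right (Nat.le_add_left _ _) _

theorem mem_STS {C : Set (F ι)} {y : F ι} {s : Set ι} :
    s ∈ STS C y ↔ ∃ v, v + y ∈ C ∧ hammingNorm v = 3 ∧ s = supp v := by
  have hself : ∀ v : F ι, v + y + y = v := fun v => by
    rw [add_assoc, add_self_eq_zero_of_binary, add_zero]
  have hdist : ∀ x : F ι, hammingDist x y = hammingNorm (x + y) := fun x => by
    rw [hammingDist_eq_hammingNorm]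
    congr 1
    funext i
    change -x i + y i = x i + y i
    rw [CharTwo.neg_eq]
  constructor
  · rintro ⟨x, hx, hd, rfl⟩
    exact ⟨x + y, by rwa [hself], by rwa [← hdist], rfl⟩
  · rintro ⟨v, hv, hn, rfl⟩
    exact ⟨v + y, hv, by rwa [hdist, hself], by rw [hself]⟩

theorem image_STS_eq {C : Set (F ι)} {y : F ι} (π : Equiv.Perm ι)
    (h : ∀ v, hammingNorm v = 3 → (v + y ∈ C ↔ permAct π v ∈ C)) :
    Set.image π '' STS C y = STS C 0 := by
  ext s
  simp only [Set.mem_image, mem_STS, add_zero]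
  constructor
  · rintro ⟨_, ⟨v, hv, hn, rfl⟩, rfl⟩
    exact ⟨permAct π v, (h v hn).1 hv, by rwa [hammingNorm_permAct], (supp_permAct π v).symm⟩
  · rintro ⟨v, hv, hn, rfl⟩
    have hπ : permAct π (permAct π⁻¹ v) = v := by
      rw [← permAct_mul, mul_inv_cancel]
      rfl
    have hn' : hammingNorm (permAct π⁻¹ v) = 3 := by rwa [hammingNorm_permAct]
    refine ⟨_, ⟨permAct π⁻¹ v, (h _ hn').2 (by rwa [hπ]), hn', rfl⟩, ?_⟩
    rw [← supp_permAct, hπ]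

/-- A Vasil'ev code of a linear code is homogeneous as soon as every derivative of `lam` agrees
on the codewords of weight at most 3, up to a symmetry of `C` and a linear function,
with `lam` itself. -/
theorem isHomogeneous_vasiliev [DecidableEq ι] {C : Set (F ι)} {lam : F ι → ZMod 2}
    (hC : ∀ x ∈ C, ∀ y ∈ C, x + y ∈ C)
    (h : ∀ y ∈ C, ∃ (σ : Equiv.Perm ι) (u : F ι), (∀ w, permAct σ w ∈ C ↔ w ∈ C) ∧
      ∀ w ∈ C, hammingNorm w ≤ 3 → lam (w + y) + lam y = lam (permAct σ w) + dot u w) :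
    IsHomogeneous (Vasiliev C lam) := by
  rintro _ ⟨x, y, hy, rfl⟩
  obtain ⟨σ, u, hσ, hlam⟩ := h y hy
  refine ⟨dup σ * tau u, image_STS_eq _ fun v hv => ?_⟩
  obtain ⟨a, b, c, rfl⟩ := exists_eq_vasVec v
  have hnorm : hammingNorm (a + c) ≤ 3 := hv ▸ hammingNorm_add_le_vasVec a c b
  have hyC : a + c + y ∈ C ↔ a + c ∈ C := by
    refine ⟨fun hw => ?_, fun hw => hC _ hw _ hy⟩
    have := hC _ hw _ hy
    rwa [add_assoc, add_self_eq_zero_of_binary, add_zero] at this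
  have hsum : a + (x + y) + (c + x) = a + c + y := by
    have : a + (x + y) + (c + x) = a + c + y + (x + x) := by abel
    rw [this, add_self_eq_zero_of_binary, add_zero]
  have hsum' : permAct σ (a + u * (a + c)) + permAct σ (c + u * (a + c)) = permAct σ (a + c) := by
    change permAct σ (a + u * (a + c) + (c + u * (a + c))) = _
    rw [add_add_add_comm, add_self_eq_zero_of_binary, add_zero]
  have hdot : wt (u * (a + c)) = dot u (a + c) := rfl
  rw [permAct_mul, permAct_tau_vasVec, permAct_dup_vasVec, vasVec_add, mem_vasiliev, mem_vasiliev,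
    hsum, hsum', hyC, hσ, wt_permAct, wt_add, wt_add, hdot]
  refine and_congr_right fun hw => ?_
  have key : ∀ b X Y c L M D : ZMod 2, L + Y = M + D →
      (b + (X + Y) = c + X + L ↔ b = c + D + M) := by decide
  exact key _ _ _ _ _ _ _ (hlam _ hw hnorm)

end Homogeneity

/-- The codeword of `H7` with prescribed coordinates `p, q, r, s` at the positions
`2, 4, 5, 6`. -/
def hammingWord (p q r s : ZMod 2) : F (Fin 7) := ![p + q + s, p + r + s, p, q + r + s, q, r, s]

theorem mem_H7 {w : F (Fin 7)} : w ∈ H7 ↔ ∃ p q r s, w = hammingWord p q r s := by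
  have hspan : ∀ a b c d : ZMod 2, a • chi {0, 1, 2} + (b • chi {0, 3, 4} +
      (c • chi {0, 5, 6} + d • chi {1, 3, 5})) = hammingWord a b (c + d) c := by decide
  simp only [H7, SetLike.mem_coe, Submodule.mem_span_insert, Submodule.mem_span_singleton]
  constructor
  · rintro ⟨a, _, ⟨b, _, ⟨c, _, ⟨d, rfl⟩, rfl⟩, rfl⟩, rfl⟩
    exact ⟨_, _, _, _, hspan a b c d⟩
  · rintro ⟨p, q, r, s, rfl⟩
    refine ⟨p, _, ⟨q, _, ⟨s, _, ⟨r + s, rfl⟩, rfl⟩, rfl⟩, ?_⟩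
    rw [hspan, add_left_comm, CharTwo.add_self_eq_zero, add_zero]

theorem H7_add_mem : ∀ x ∈ H7, ∀ y ∈ H7, x + y ∈ H7 :=
  fun _ hx _ hy => Submodule.add_mem _ hx hy

/-- A cyclic symmetry of order 7 of the Hamming code `H7`. -/
def singer : Equiv.Perm (Fin 7) where
  toFun := ![1, 3, 5, 2, 0, 6, 4]
  invFun := ![4, 0, 3, 1, 6, 2, 5]
  left_inv := by decide
  right_inv := by decide

theorem permAct_singer_mem_H7 (w : F (Fin 7)) : permAct singer w ∈ H7 ↔ w ∈ H7 := by
  have h1 : ∀ p q r s, permAct singer (hammingWord p q r s) =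
      hammingWord (q + r + s) s p r := by decide
  have h2 : ∀ p q r s, permAct singer⁻¹ (hammingWord p q r s) =
      hammingWord r (p + q + s) s q := by decide
  constructor
  · intro h
    obtain ⟨p, q, r, s, h⟩ := mem_H7.1 h
    refine mem_H7.2 ⟨_, _, _, _, (?_ : w = _).trans (h2 p q r s)⟩
    rw [← h, ← permAct_mul, inv_mul_cancel]
    rfl
  · intro h
    obtain ⟨p, q, r, s, rfl⟩ := mem_H7.1 h
    exact mem_H7.2 ⟨_, _, _, _, h1 p q r s⟩

theorem permAct_singer_pow_mem_H7 (k : ℕ) (w : F (Fin 7)) :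
    permAct (singer ^ k) w ∈ H7 ↔ w ∈ H7 := by
  induction k with
  | zero => rfl
  | succ k ih => rw [pow_succ', permAct_mul, permAct_singer_mem_H7, ih]

theorem isHomogeneous_vasiliev_H7 {lam : F (Fin 7) → ZMod 2}
    (h : ∀ p q r s : ZMod 2, ∃ (k : Fin 7) (t₁ t₂ t₃ t₄ : ZMod 2), ∀ p' q' r' s' : ZMod 2,
      hammingNorm (hammingWord p' q' r' s') ≤ 3 →
      lam (hammingWord (p' + p) (q' + q) (r' + r) (s' + s)) + lam (hammingWord p q r s) =
        lam (permAct (singer ^ (k : ℕ)) (hammingWord p' q' r' s')) +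
          (t₁ * p' + t₂ * q' + t₃ * r' + t₄ * s')) :
    IsHomogeneous (Vasiliev H7 lam) := by
  refine isHomogeneous_vasiliev H7_add_mem fun y hy => ?_
  obtain ⟨p, q, r, s, rfl⟩ := mem_H7.1 hy
  obtain ⟨k, t₁, t₂, t₃, t₄, hk⟩ := h p q r s
  refine ⟨singer ^ (k : ℕ), ![0, 0, t₁, 0, t₂, t₃, t₄], permAct_singer_pow_mem_H7 k, ?_⟩
  intro w hw hn
  obtain ⟨p', q', r', s', rfl⟩ := mem_H7.1 hw
  have hadd : hammingWord p' q' r' s' + hammingWord p q r s =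
      hammingWord (p' + p) (q' + q) (r' + r) (s' + s) := by
    funext i
    fin_cases i <;> simp [hammingWord] <;> ring
  have hdot : dot ![0, 0, t₁, 0, t₂, t₃, t₄] (hammingWord p' q' r' s') =
      t₁ * p' + t₂ * q' + t₃ * r' + t₄ * s' := by
    simp [dot, Fin.sum_univ_succ, hammingWord]
    ring
  rw [hadd, hdot]
  exact hk p' q' r' s' hn

theorem isHomogeneous_vasiliev_lamV22 : IsHomogeneous (Vasiliev H7 lamV22) :=
  isHomogeneous_vasiliev_H7 (by decide +kernel)

theorem isHomogeneous_vasiliev_lamV3 : IsHomogeneous (Vasiliev H7 lamV3) :=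
  isHomogeneous_vasiliev_H7 (by decide +kernel)

/-- STATEMENT 11: the codes `V22^1` and `V3^11` are homogeneous. -/
theorem stmt11 :
    IsHomogeneous (Vasiliev H7 lamV22) ∧ IsHomogeneous (Vasiliev H7 lamV3) :=
  ⟨isHomogeneous_vasiliev_lamV22, isHomogeneous_vasiliev_lamV3⟩
end
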